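/- arXiv:1507.01925 — 3 statements merged into one kernel-verified Lean document; each statement's English description precedes it below -/
import Mathlib

section
/- Let R be a commutative ring, I ⊆ R a nilpotent ideal, and M an R-module. If M/IM is flat as an R/I-module and Tor_1^R(R/I, M) = 0, then M is flat as an R-module. -/
open CategoryTheory
open TensorProduct
universe u

theorem snakeAux {R : Type*} [CommRing R] {A B C K F M : Type*}
    [AddCommGroup A] [AddCommGroup B] [AddCommGroup C]
    [AddCommGroup K] [AddCommGroup F] [AddCommGroup M]
    [Module R A] [Module R B] [Module R C] [Module R K] [Module R F] [Module R M]
    (f : A →ₗ[R] B) (g : B →ₗ[R] C) (i : K →ₗ[R] F) (p : F →ₗ[R] M)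
    (hfg : Function.Exact f g) (hg : Function.Surjective g)
    (hip : Function.Exact i p) (hp : Function.Surjective p)
    (h1 : Function.Injective (f.rTensor F)) (h2 : Function.Injective (i.lTensor C)) :
    Function.Injective (f.rTensor M) := by
  rw [injective_iff_map_eq_zero]
  intro x hx
  obtain ⟨y, rfl⟩ := LinearMap.lTensor_surjective A hp x
  have c1 : p.lTensor B (f.rTensor F y) = 0 := by
    rw [← hx, ← LinearMap.comp_apply, ← LinearMap.comp_apply,
      LinearMap.lTensor_comp_rTensor, LinearMap.rTensor_comp_lTensor]
  obtain ⟨z, hz⟩ := (lTensor_exact B hip hp _).1 c1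
  have c2 : g.rTensor K z = 0 := by
    apply h2
    rw [map_zero, ← LinearMap.comp_apply, LinearMap.lTensor_comp_rTensor,
      ← LinearMap.rTensor_comp_lTensor, LinearMap.comp_apply, hz]
    exact (rTensor_exact F hfg hg _).2 ⟨y, rfl⟩
  obtain ⟨w, rfl⟩ := (rTensor_exact K hfg hg _).1 c2
  have c3 : y = i.lTensor A w := by
    apply h1
    rw [← hz, ← LinearMap.comp_apply, ← LinearMap.comp_apply,
      LinearMap.lTensor_comp_rTensor, LinearMap.rTensor_comp_lTensor]
  exact (lTensor_exact A hip hp _).2 ⟨w, c3.symm⟩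

theorem injective_of_flat_coker_aux {S : Type u} [CommRing S] {K F M A L N : Type u}
    [AddCommGroup K] [AddCommGroup F] [AddCommGroup M]
    [Module S K] [Module S F] [Module S M] [Module.Flat S M]
    [AddCommGroup A] [AddCommGroup L] [AddCommGroup N]
    [Module S A] [Module S L] [Module S N] [Module.Flat S L]
    (i : K →ₗ[S] F) (p : F →ₗ[S] M) (hi : Function.Injective i)
    (hip : Function.Exact i p) (hp : Function.Surjective p)
    (j : A →ₗ[S] L) (g : L →ₗ[S] N) (hj : Function.Injective j)
    (hjg : Function.Exact j g) (hg : Function.Surjective g) :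
    Function.Injective (i.rTensor N) :=
  snakeAux i p j g hip hp hjg hg
    (Module.Flat.rTensor_preserves_injective_linearMap _ hi)
    (Module.Flat.lTensor_preserves_injective_linearMap _ hj)

/-- Tensoring an exact sequence with flat cokernel. -/
theorem injective_of_flat_coker {S : Type u} [CommRing S] {K F M : Type u}
    [AddCommGroup K] [AddCommGroup F] [AddCommGroup M]
    [Module S K] [Module S F] [Module S M] [Module.Flat S M]
    (i : K →ₗ[S] F) (p : F →ₗ[S] M) (hi : Function.Injective i)
    (hip : Function.Exact i p) (hp : Function.Surjective p)
    (N : Type u) [AddCommGroup N] [Module S N] :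
    Function.Injective (i.lTensor N) := by
  have q := Finsupp.linearCombination_id_surjective S N
  let g : (N →₀ S) →ₗ[S] N := Finsupp.linearCombination S (id : N → N)
  let j : LinearMap.ker g →ₗ[S] (N →₀ S) := (LinearMap.ker g).subtype
  have hj : Function.Injective j := Submodule.subtype_injective _
  have hjg : Function.Exact j g := LinearMap.exact_subtype_ker_map _
  have hF : Module.Flat S (N →₀ S) := inferInstance
  have := injective_of_flat_coker_aux (A := LinearMap.ker g) (L := N →₀ S) i p hi hip hp j g hj hjg q
  exact (LinearMap.lTensor_inj_iff_rTensor_inj N i).2 this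

theorem injective_of_quot {R S : Type u} [CommRing R] [CommRing S] [Algebra R S] {K F M : Type u}
    [AddCommGroup K] [AddCommGroup F] [AddCommGroup M]
    [Module R K] [Module R F] [Module R M] [Module.Flat S (S ⊗[R] M)]
    (i : K →ₗ[R] F) (p : F →ₗ[R] M) (hi : Function.Injective (i.lTensor S))
    (hip : Function.Exact i p) (hp : Function.Surjective p)
    (N : Type u) [AddCommGroup N] [Module R N] [Module S N] [IsScalarTower R S N] :
    Function.Injective (i.lTensor N) := by
  have := injective_of_flat_coker (i.baseChange S) (p.baseChange S) hi
    (lTensor_exact S hip hp) (LinearMap.lTensor_surjective S hp) N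
  have e : i.lTensor N = (((AlgebraTensorModule.cancelBaseChange R S S N F).restrictScalars R).toLinearMap ∘ₗ
    ((i.baseChange S).lTensor N).restrictScalars R) ∘ₗ
      ((AlgebraTensorModule.cancelBaseChange R S S N K).symm.restrictScalars R).toLinearMap := by
    ext n k; simp
  rw [e]
  simpa using this

theorem injective_of_nilp {R : Type u} [CommRing R] (I : Ideal R) {K F M : Type u}
    [AddCommGroup K] [AddCommGroup F] [AddCommGroup M]
    [Module R K] [Module R F] [Module R M] [Module.Flat (R ⧸ I) ((R ⧸ I) ⊗[R] M)] [Module.Flat R F]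
    (i : K →ₗ[R] F) (p : F →ₗ[R] M) (hi : Function.Injective (i.lTensor (R ⧸ I)))
    (hip : Function.Exact i p) (hp : Function.Surjective p) (n : ℕ) :
    ∀ (N : Type u) [AddCommGroup N] [Module R N], (I ^ n • ⊤ : Submodule R N) = ⊥ →
    Function.Injective (i.lTensor N) := by
  induction n with
  | zero =>
    intro N _ _ h
    have : Subsingleton N := by
      rw [← Submodule.subsingleton_iff R]
      exact subsingleton_of_bot_eq_top (by simpa using h.symm)
    exact Function.injective_of_subsingleton _
  | succ n ih =>
    intro N _ _ h
    set J : Submodule R N := I • ⊤ with hJ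
    have a1 : Function.Injective (i.lTensor J) := by
      apply ih
      apply Submodule.map_injective_of_injective J.subtype_injective
      rw [Submodule.map_smul'', Submodule.map_bot, Submodule.map_top, Submodule.range_subtype, hJ,
        ← Submodule.mul_smul, ← pow_succ, h]
    have a2 : Function.Injective (i.lTensor (N ⧸ J)) := 
      injective_of_quot (S := R ⧸ I) i p hi hip hp _
    have ex : Function.Exact J.subtype J.mkQ := LinearMap.exact_subtype_mkQ J
    rw [injective_iff_map_eq_zero]
    intro x hx
    have c1 : J.mkQ.rTensor K x = 0 := by
      apply a2
      rw [map_zero, ← LinearMap.comp_apply, LinearMap.lTensor_comp_rTensor,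
        ← LinearMap.rTensor_comp_lTensor, LinearMap.comp_apply, hx, map_zero]
    obtain ⟨w, rfl⟩ := (rTensor_exact K ex J.mkQ_surjective _).1 c1
    have : w = 0 := by
      apply a1
      apply Module.Flat.rTensor_preserves_injective_linearMap (M := F) _ J.subtype_injective
      rw [map_zero, map_zero, ← hx, ← LinearMap.comp_apply, ← LinearMap.comp_apply,
        LinearMap.lTensor_comp_rTensor, LinearMap.rTensor_comp_lTensor]
    rw [this, map_zero]

theorem flat_aux {R : Type u} [CommRing R] (I : Ideal R) (hI : IsNilpotent I) {P₂ P₁ F M : Type u}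
    [AddCommGroup P₂] [AddCommGroup P₁] [AddCommGroup F] [AddCommGroup M]
    [Module R P₂] [Module R P₁] [Module R F] [Module R M] [Module.Flat R F]
    (hflat : Module.Flat (R ⧸ I) (M ⧸ (I • ⊤ : Submodule R M)))
    (d₂ : P₂ →ₗ[R] P₁) (d₁ : P₁ →ₗ[R] F) (p : F →ₗ[R] M)
    (h0 : d₁ ∘ₗ d₂ = 0) (h1 : Function.Exact d₁ p) (hp : Function.Surjective p)
    (h : Function.Exact (d₂.lTensor (R ⧸ I)) (d₁.lTensor (R ⧸ I))) : Module.Flat R M := by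
  have : Module.Flat (R ⧸ I) ((R ⧸ I) ⊗[R] M) :=
    Module.Flat.of_linearEquiv ((TensorProduct.quotTensorEquivQuotSMul M I).extendScalarsOfSurjective
      Ideal.Quotient.mk_surjective)
  obtain ⟨n, hn⟩ := hI
  let i := (LinearMap.ker p).subtype
  let q : P₁ →ₗ[R] LinearMap.ker p := d₁.codRestrict _ fun x => (h1 _).2 ⟨x, rfl⟩
  have hq : Function.Surjective q := by
    rintro ⟨y, hy⟩
    obtain ⟨x, rfl⟩ := (h1 y).1 hy
    exact ⟨x, rfl⟩
  have hiq : i ∘ₗ q = d₁ := rfl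
  have hqd : q ∘ₗ d₂ = 0 := by
    ext x; exact LinearMap.congr_fun h0 x
  have hi : Function.Injective (i.lTensor (R ⧸ I)) := by
    rw [injective_iff_map_eq_zero]
    intro x hx
    obtain ⟨y, rfl⟩ := LinearMap.lTensor_surjective _ hq x
    rw [← LinearMap.comp_apply, ← LinearMap.lTensor_comp, hiq] at hx
    obtain ⟨w, rfl⟩ := (h _).1 hx
    rw [← LinearMap.comp_apply, ← LinearMap.lTensor_comp, hqd]
    simp
  have hip : Function.Exact i p := LinearMap.exact_subtype_ker_map _
  rw [Module.Flat.iff_rTensor_preserves_injective_linearMap.{u}]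
  intro A B _ _ _ _ f hf
  refine snakeAux f (LinearMap.range f).mkQ i p (LinearMap.exact_map_mkQ_range f)
    (Submodule.mkQ_surjective _) hip hp (Module.Flat.rTensor_preserves_injective_linearMap _ hf) ?_
  exact injective_of_nilp I i p hi hip hp n _ (by rw [hn]; simp)

/-- Let `I` be a nilpotent ideal of `R` and `M` an `R`-module. If `M/IM` is flat over `R/I`
and `Tor₁ᴿ(R/I, M) = 0`, then `M` is flat over `R`. -/
theorem flat_of_flat_quotient_of_tor_eq_zero {R : Type u} [CommRing R] (I : Ideal R)
    (hI : IsNilpotent I) (M : Type u) [AddCommGroup M] [Module R M]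
    (hflat : Module.Flat (R ⧸ I) (M ⧸ (I • ⊤ : Submodule R M)))
    (htor : Limits.IsZero
      (((Tor (ModuleCat.{u} R) 1).obj (ModuleCat.of R (R ⧸ I))).obj (ModuleCat.of R M))) :
    Module.Flat R M := by
  let P := projectiveResolution (ModuleCat.of R M)
  have hz := htor.of_iso (P.isoLeftDerivedObj
    ((MonoidalCategory.tensoringLeft (ModuleCat.{u} R)).obj (ModuleCat.of R (R ⧸ I))) 1).symm
  have hz2 := (HomologicalComplex.exactAt_iff_isZero_homology _ 1).2 hz
  rw [HomologicalComplex.exactAt_iff' _ 2 1 0 (by simp) (by simp)] at hz2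
  rw [ShortComplex.ShortExact.moduleCat_exact_iff_function_exact] at hz2
  have e0 := P.exact₀
  rw [ShortComplex.ShortExact.moduleCat_exact_iff_function_exact] at e0
  have hproj : Module.Projective R (P.complex.X 0) :=
    (IsProjective.iff_projective _).2 (P.projective 0)
  have hs : Function.Surjective (P.π.f 0).hom :=
    (ModuleCat.epi_iff_surjective _).1 inferInstance
  refine flat_aux I hI (F := P.complex.X 0) (M := M) hflat (P.complex.d 2 1).hom (P.complex.d 1 0).hom (P.π.f 0).hom ?_ e0 hs hz2
  rw [← ModuleCat.hom_comp, P.complex.d_comp_d]; rfl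
end

section
/- Let A → B be a finitely presented homomorphism of commutative rings such that: (1) Ω_{B/A} is a finitely generated projective B-module, (2) for every prime p of A with residue field κ(p), the fiber B ⊗_A κ(p) is a smooth κ(p)-algebra, and (3) Tor_1^A(B, κ(p)) = 0 for every prime p of A. Then B is a smooth A-algebra. -/
open TensorProduct CategoryTheory
universe u

/-- Extract an elementary injectivity statement from the vanishing of `Tor₁`. -/
lemma tor_aux {A : Type u} [CommRing A] (B k : Type u) [AddCommGroup B] [Module A B]
    [AddCommGroup k] [Module A k]
    (h : Limits.IsZero (((Tor (ModuleCat.{u} A) 1).obj (ModuleCat.of A B)).obj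
        (ModuleCat.of A k))) :
    ∃ (F N : Type u) (_ : AddCommGroup F) (_ : AddCommGroup N) (_ : Module A F) (_ : Module A N)
      (i : N →ₗ[A] F) (g : F →ₗ[A] k), Module.Flat A F ∧ Function.Surjective g ∧
        Function.Exact i g ∧ Function.Injective (i.lTensor B) := by
  let Q := projectiveResolution (ModuleCat.of A k)
  let T := (MonoidalCategory.tensoringLeft (ModuleCat.{u} A)).obj (ModuleCat.of A B)
  have h1 := h.of_iso (Q.isoLeftDerivedObj T 1).symm
  have h2 : ((T.mapHomologicalComplex _).obj Q.complex).ExactAt 1 := by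
    rw [HomologicalComplex.exactAt_iff_isZero_homology]
    exact h1
  rw [HomologicalComplex.exactAt_iff' _ 2 1 0 (by simp) (by simp),
    ShortComplex.ShortExact.moduleCat_exact_iff_function_exact] at h2
  have h3 := Q.exact₀
  rw [ShortComplex.ShortExact.moduleCat_exact_iff_function_exact] at h3
  let d1 : Q.complex.X 1 →ₗ[A] Q.complex.X 0 := (Q.complex.d 1 0).hom
  let d2 : Q.complex.X 2 →ₗ[A] Q.complex.X 1 := (Q.complex.d 2 1).hom
  have h2' : Function.Exact (d2.lTensor B) (d1.lTensor B) := h2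
  have hd : d1 ∘ₗ d2 = 0 := by
    have := Q.complex.d_comp_d 2 1 0
    exact congrArg ModuleCat.Hom.hom this
  let g : Q.complex.X 0 →ₗ[A] k := (Q.π.f 0).hom
  have h3' : Function.Exact d1 g := h3
  have hsurj : Function.Surjective g := (ModuleCat.epi_iff_surjective (Q.π.f 0)).mp inferInstance
  have hproj : Module.Projective A (Q.complex.X 0) :=
    (IsProjective.iff_projective (R := A) (Q.complex.X 0)).mpr (Q.projective 0)
  refine ⟨Q.complex.X 0, LinearMap.range d1, inferInstance, inferInstance, inferInstance,
    inferInstance, (LinearMap.range d1).subtype, g, inferInstance, hsurj, ?_, ?_⟩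
  · intro x
    rw [h3' x]
    simp
  · rw [injective_iff_map_eq_zero]
    intro y hy
    obtain ⟨x, rfl⟩ := LinearMap.lTensor_surjective B d1.surjective_rangeRestrict y
    rw [← LinearMap.comp_apply, ← LinearMap.lTensor_comp] at hy
    have hx : d1.lTensor B x = 0 := hy
    obtain ⟨z, rfl⟩ := (h2' x).mp hx
    rw [← LinearMap.comp_apply, ← LinearMap.lTensor_comp]
    have : d1.rangeRestrict ∘ₗ d2 = 0 := by
      ext x
      exact LinearMap.congr_fun hd x
    rw [this]; simp

lemma chase_aux {A F N k I P S : Type*} [CommRing A] [AddCommGroup F] [AddCommGroup N]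
    [AddCommGroup k] [AddCommGroup I] [AddCommGroup P] [AddCommGroup S]
    [Module A F] [Module A N] [Module A k] [Module A I] [Module A P] [Module A S]
    (i : N →ₗ[A] F) (g : F →ₗ[A] k) [Module.Flat A F] (hg : Function.Surjective g)
    (hig : Function.Exact i g) (hi : Function.Injective (i.lTensor S))
    (j : I →ₗ[A] P) (f : P →ₗ[A] S) (hj : Function.Injective j) (hf : Function.Surjective f)
    (hjf : Function.Exact j f) : Function.Injective (j.lTensor k) := by
  have hi' : Function.Injective (i.rTensor S) := by
    rwa [← LinearMap.lTensor_inj_iff_rTensor_inj]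
  rw [injective_iff_map_eq_zero]
  intro x hx
  obtain ⟨y, rfl⟩ := LinearMap.rTensor_surjective I hg x
  have e1 : g.rTensor P (j.lTensor F y) = 0 := by
    rw [← hx, ← LinearMap.comp_apply, ← LinearMap.comp_apply, LinearMap.rTensor_comp_lTensor,
      LinearMap.lTensor_comp_rTensor]
  obtain ⟨z, hz⟩ := (rTensor_exact P hig hg _).mp e1
  have e2 : f.lTensor N z = 0 := by
    apply hi'
    rw [map_zero, ← LinearMap.comp_apply, LinearMap.rTensor_comp_lTensor,
      ← LinearMap.lTensor_comp_rTensor, LinearMap.comp_apply, hz]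
    exact (lTensor_exact F hjf hf).apply_apply_eq_zero y
  obtain ⟨w, rfl⟩ := (lTensor_exact N hjf hf _).mp e2
  have e3 : i.rTensor I w = y := by
    apply Module.Flat.lTensor_preserves_injective_linearMap (M := F) j hj
    rw [← hz, ← LinearMap.comp_apply, ← LinearMap.comp_apply, LinearMap.rTensor_comp_lTensor,
      LinearMap.lTensor_comp_rTensor]
  rw [← e3]
  exact (rTensor_exact I hig hg).apply_apply_eq_zero w

lemma loc_aux {A B C F N : Type*} [CommRing A] [CommRing B] [CommRing C] [Algebra A B]
    [Algebra B C] [Algebra A C] [IsScalarTower A B C] [Module.Flat B C] [AddCommGroup F]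
    [AddCommGroup N] [Module A F] [Module A N] (i : N →ₗ[A] F)
    (h : Function.Injective (i.lTensor B)) : Function.Injective (i.lTensor C) := by
  have h1 : Function.Injective ((i.baseChange B).lTensor C) :=
    Module.Flat.lTensor_preserves_injective_linearMap _ h
  have h2 : (i.lTensor C : C ⊗[A] N → C ⊗[A] F) =
      (AlgebraTensorModule.cancelBaseChange A B B C F) ∘ ((i.baseChange B).lTensor C) ∘
        (AlgebraTensorModule.cancelBaseChange A B B C N).symm := by
    ext x
    induction x with
    | zero => simp
    | add x y hx hy => simp only [map_add, hx, hy, Function.comp_apply] at *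
    | tmul x y => simp
  rw [h2]
  exact (LinearEquiv.injective _).comp (h1.comp (LinearEquiv.injective _))

open KaehlerDifferential in
lemma key_aux {R P S R' P' S' K : Type*} [CommRing R] [CommRing P] [CommRing S]
    [CommRing R'] [CommRing P'] [CommRing S'] [CommRing K]
    [Algebra R P] [Algebra P S] [Algebra R' P'] [Algebra P' S']
    [Algebra R R'] [Algebra R P'] [IsScalarTower R R' P'] [Algebra P P'] [IsScalarTower R P P']
    [Algebra S K] [Algebra P K] [IsScalarTower P S K]
    [Algebra S' K] [Algebra P' K] [IsScalarTower P' S' K] [IsScalarTower P P' K]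
    (j : RingHom.ker (algebraMap P S) →ₗ[P] RingHom.ker (algebraMap P' S'))
    (hj : ∀ x, (j x : P') = algebraMap P P' x)
    (hbc : Function.Bijective (j.liftBaseChange P'))
    (h : Function.Injective (cotangentComplexBaseChange R' S' P' K)) :
    Function.Injective (cotangentComplexBaseChange R S P K) := by
  let e := LinearEquiv.ofBijective _ hbc
  let u : K ⊗[P] RingHom.ker (algebraMap P S) ≃ₗ[K] K ⊗[P'] RingHom.ker (algebraMap P' S') :=
    (AlgebraTensorModule.cancelBaseChange P P' K K _).symm ≪≫ₗ
      AlgebraTensorModule.congr (.refl K K) e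
  let v : K ⊗[P] Ω[P⁄R] →ₗ[K] K ⊗[P'] Ω[P'⁄R'] :=
    LinearMap.liftBaseChange K
      (((TensorProduct.mk P' K Ω[P'⁄R'] 1).restrictScalars P).comp (KaehlerDifferential.map R R' P P'))
  have huv : v ∘ₗ cotangentComplexBaseChange R S P K =
      cotangentComplexBaseChange R' S' P' K ∘ₗ u.toLinearMap := by
    ext x
    simp [u, v, e, cotangentComplexBaseChange_tmul, hj]
  have : Function.Injective (v ∘ₗ cotangentComplexBaseChange R S P K) := by
    rw [huv]
    exact h.comp u.injective
  exact Function.Injective.of_comp this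

attribute [local instance] Algebra.TensorProduct.rightAlgebra in
lemma ker_aux {R k P S : Type*} [CommRing R] [CommRing k] [Algebra R k] [CommRing P] [CommRing S]
    [Algebra R P] [Algebra R S] [Algebra P S] [IsScalarTower R P S]
    (h₁ : Function.Surjective (algebraMap P S))
    (hinj : Function.Injective
      (((RingHom.ker (algebraMap P S)).subtype.restrictScalars R).lTensor k)) :
    ∃ j : RingHom.ker (algebraMap P S) →ₗ[P]
      RingHom.ker (Algebra.TensorProduct.map (.id k k) (IsScalarTower.toAlgHom R P S)),
      (∀ x, (j x : k ⊗[R] P) = algebraMap P (k ⊗[R] P) x) ∧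
      Function.Bijective (j.liftBaseChange (k ⊗[R] P)) := by
  let φ := (Algebra.TensorProduct.map (.id k k) (IsScalarTower.toAlgHom R P S))
  let j : RingHom.ker (algebraMap P S) →ₗ[P] RingHom.ker φ :=
    { toFun := fun x => ⟨1 ⊗ₜ x.1, by
        have := x.2
        rw [RingHom.mem_ker] at this
        simp [φ, RingHom.mem_ker, this]⟩
      map_add' := fun x y => by ext1; simp [tmul_add]
      map_smul' := fun r x => by
        ext1
        simp [Algebra.smul_def, Algebra.TensorProduct.right_algebraMap_apply] }
  refine ⟨j, fun x => rfl, ?_⟩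
  let w : k ⊗[R] RingHom.ker (algebraMap P S) →ₗ[R] (k ⊗[R] P) ⊗[P] RingHom.ker (algebraMap P S) :=
    TensorProduct.lift (LinearMap.mk₂ R (fun a x => (a ⊗ₜ[R] (1 : P)) ⊗ₜ[P] x)
      (by intros; simp [add_tmul]) (by intros; simp [smul_tmul'])
      (by intros; simp [tmul_add]) (by intros; simp))
  have hwt : ∀ a x, w (a ⊗ₜ x) = (a ⊗ₜ[R] (1 : P)) ⊗ₜ[P] x := fun _ _ => rfl
  have hw : Function.Surjective w := by
    intro x
    induction x with
    | zero => exact ⟨0, by simp⟩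
    | add x y hx hy =>
      obtain ⟨a, rfl⟩ := hx
      obtain ⟨b, rfl⟩ := hy
      exact ⟨a + b, by simp⟩
    | tmul x y =>
      induction x with
      | zero => exact ⟨0, by simp⟩
      | add x y hx hy =>
        obtain ⟨a, ha⟩ := hx
        obtain ⟨b, hb⟩ := hy
        exact ⟨a + b, by simp [ha, hb, add_tmul]⟩
      | tmul a p =>
        refine ⟨a ⊗ₜ (p • y), ?_⟩
        rw [hwt, ← smul_tmul]
        congr 1
        simp [Algebra.smul_def, Algebra.TensorProduct.right_algebraMap_apply]
  have hjw : ∀ x, ((j.liftBaseChange (k ⊗[R] P) (w x) : RingHom.ker φ) : k ⊗[R] P) =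
      ((RingHom.ker (algebraMap P S)).subtype.restrictScalars R).lTensor k x := by
    intro x
    induction x with
    | zero => simp
    | add x y hx hy => simp only [map_add, ← hx, ← hy, Submodule.coe_add]
    | tmul a y => simp [hwt, j]
  constructor
  · rw [injective_iff_map_eq_zero]
    intro x hx
    obtain ⟨y, rfl⟩ := hw x
    have := hjw y
    rw [hx] at this
    have : y = 0 := by
      apply hinj
      rw [map_zero, ← this]; rfl
    simp [this]
  · rintro ⟨x, hx⟩
    have hex : Function.Exact ((RingHom.ker (algebraMap P S)).subtype.restrictScalars R)
      (IsScalarTower.toAlgHom R P S).toLinearMap := by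
      intro x
      simp [RingHom.mem_ker]
    obtain ⟨y, rfl⟩ := (lTensor_exact k hex h₁ x).mp hx
    exact ⟨w y, Subtype.ext (hjw y)⟩

open IsLocalRing in
attribute [local instance] Algebra.TensorProduct.rightAlgebra in
lemma local_aux {R k P S : Type*} [CommRing R] [Field k] [Algebra R k] [CommRing P] [CommRing S]
    [IsLocalRing S]
    [Algebra R P] [Algebra R S] [Algebra P S] [IsScalarTower R P S]
    [Algebra k (ResidueField S)] [IsScalarTower R k (ResidueField S)]
    [Algebra.FormallySmooth k (k ⊗[R] S)]
    [Algebra.FormallySmooth R P] [Module.Free P Ω[P⁄R]] [Module.Finite P Ω[P⁄R]]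
    (h₁ : Function.Surjective (algebraMap P S)) (h₂ : (RingHom.ker (algebraMap P S)).FG)
    (hs : Function.Surjective (algebraMap S (k ⊗[R] S)))
    (hinj : Function.Injective
      (((RingHom.ker (algebraMap P S)).subtype.restrictScalars R).lTensor k)) :
    Algebra.FormallySmooth R S := by
  obtain ⟨j, hj, hbc⟩ := ker_aux (k := k) h₁ hinj
  let φ : k ⊗[R] P →ₐ[k] k ⊗[R] S :=
    Algebra.TensorProduct.map (.id k k) (IsScalarTower.toAlgHom R P S)
  let ψ : k ⊗[R] S →ₐ[R] ResidueField S :=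
    Algebra.TensorProduct.lift (IsScalarTower.toAlgHom R k (ResidueField S))
      (IsScalarTower.toAlgHom R S (ResidueField S)) fun _ _ ↦ .all _ _
  have hψ : ∀ s, ψ (algebraMap S (k ⊗[R] S) s) = algebraMap S (ResidueField S) s := by
    intro s
    simp [ψ, Algebra.TensorProduct.right_algebraMap_apply]
  have : Nontrivial (k ⊗[R] S) := ψ.toRingHom.domain_nontrivial
  have : IsLocalRing (k ⊗[R] S) := .of_surjective' _ hs
  let := φ.toRingHom.toAlgebra
  let := ψ.toRingHom.toAlgebra
  let : Algebra (k ⊗[R] P) (ResidueField S) := (ψ.toRingHom.comp φ.toRingHom).toAlgebra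
  have hψφ : ∀ x : k ⊗[R] P, algebraMap (k ⊗[R] P) (ResidueField S) x = ψ (φ x) := fun _ => rfl
  have : IsScalarTower k (k ⊗[R] P) (k ⊗[R] S) := .of_algebraMap_eq' φ.comp_algebraMap.symm
  have : IsScalarTower (k ⊗[R] P) (k ⊗[R] S) (ResidueField S) := .of_algebraMap_eq' rfl
  have : IsScalarTower P (k ⊗[R] P) (ResidueField S) := .of_algebraMap_eq fun x ↦ by
    rw [IsScalarTower.algebraMap_apply P S, ← hψ]
    rw [hψφ]
    simp [φ, Algebra.TensorProduct.right_algebraMap_apply]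
  have : Algebra.IsPushout R k P (k ⊗[R] P) := inferInstance
  let e₀ : Ω[(k ⊗[R] P)⁄k] ≃ₗ[k ⊗[R] P] (k ⊗[R] P) ⊗[P] Ω[P⁄R] :=
    (KaehlerDifferential.tensorKaehlerEquiv R k P (k ⊗[R] P)).symm
  have : Module.Free (k ⊗[R] P) Ω[(k ⊗[R] P)⁄k] := .of_equiv e₀.symm
  have : Module.Finite (k ⊗[R] P) Ω[(k ⊗[R] P)⁄k] := .equiv e₀.symm
  have h₁' : Function.Surjective φ := LinearMap.lTensor_surjective _ h₁
  have h₂' : (RingHom.ker φ).FG := by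
    suffices Module.Finite (k ⊗[R] P) (RingHom.ker φ) from (Submodule.fg_top _).mp this.1
    have : Module.Finite P (RingHom.ker (algebraMap P S)) := ⟨(Submodule.fg_top _).mpr h₂⟩
    exact .equiv (LinearEquiv.ofBijective _ hbc)
  have h₃ : maximalIdeal (k ⊗[R] S) ≤ RingHom.ker (algebraMap (k ⊗[R] S) (ResidueField S)) := by
    intro x hx
    obtain ⟨x, rfl⟩ := hs x
    have : ¬IsUnit x := fun h ↦ hx <| h.map _
    change ψ _ = 0
    rw [hψ]
    simpa
  rw [Algebra.FormallySmooth.iff_injective_cotangentComplexBaseChange_residueField (P := P) h₁ h₂]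
  have := (Algebra.FormallySmooth.iff_injective_cotangentComplexBaseChange
    (R := k) (k ⊗[R] P) (ResidueField S) h₁' h₂' h₃).mp inferInstance
  exact key_aux j hj hbc this

attribute [local instance] Algebra.TensorProduct.rightAlgebra in
lemma fiber_aux {A B k S : Type*} [CommRing A] [CommRing B] [CommRing k] [CommRing S]
    [Algebra A B] [Algebra A k] [Algebra B S] [Algebra A S] [IsScalarTower A B S]
    (M : Submonoid B) [IsLocalization M S] [Algebra.FormallySmooth k (k ⊗[A] B)] :
    Algebra.FormallySmooth k (k ⊗[A] S) := by
  have : Algebra.FormallyEtale B S := .of_isLocalization M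
  have : Algebra.FormallySmooth k ((k ⊗[A] B) ⊗[B] S) := .comp _ (k ⊗[A] B) _
  let e : k ⊗[A] B ≃ₐ[B] B ⊗[A] k :=
    { __ := Algebra.TensorProduct.comm _ _ _, commutes' _ := rfl }
  let e' : (k ⊗[A] B) ⊗[B] S ≃ₐ[A] k ⊗[A] S :=
    ((Algebra.TensorProduct.comm _ _ _).restrictScalars A).trans <|
    ((Algebra.TensorProduct.congr (.refl (R := B)) e).restrictScalars A).trans <|
    ((Algebra.TensorProduct.cancelBaseChange _ _ B _ _).restrictScalars A).trans <|
    (Algebra.TensorProduct.comm _ _ _)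
  have he : ∀ r : k, e' ((r ⊗ₜ 1) ⊗ₜ 1) = r ⊗ₜ 1 := by
    intro r
    simp [e', e]
  let e'' : (k ⊗[A] B) ⊗[B] S ≃ₐ[k] k ⊗[A] S :=
    { __ := e', commutes' r := he r }
  exact .of_equiv e''

attribute [local instance] Algebra.TensorProduct.rightAlgebra in
lemma surj_aux {A k S : Type*} [CommRing A] [CommRing k] [CommRing S]
    [Algebra A k] [Algebra A S] 
    (h : ∀ x : k, ∃ a t : A, IsUnit (algebraMap A S t) ∧ t • x = algebraMap A k a) :
    Function.Surjective (algebraMap S (k ⊗[A] S)) := by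
  intro x
  induction x with
  | zero => exact ⟨0, by simp⟩
  | add x y hx hy =>
    obtain ⟨a, rfl⟩ := hx
    obtain ⟨b, rfl⟩ := hy
    exact ⟨a + b, by simp⟩
  | tmul x s =>
    obtain ⟨a, t, ht, hx⟩ := h x
    obtain ⟨u, hu⟩ := ht
    refine ⟨a • ((↑u⁻¹ : S) * s), ?_⟩
    have hs : s = t • ((↑u⁻¹ : S) * s) := by
      rw [Algebra.smul_def, ← hu, ← mul_assoc]; simp
    conv_rhs => rw [hs, ← smul_tmul, hx, Algebra.algebraMap_eq_smul_one, smul_tmul]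
    rfl

lemma smoothAt_aux {A B : Type u} [CommRing A] [CommRing B] [Algebra A B]
    [Algebra.FinitePresentation A B] (p : Ideal A) [p.IsPrime] (q : Ideal B) [q.IsPrime]
    [q.LiesOver p]
    (hfib : Algebra.Smooth (IsLocalRing.ResidueField (Localization.AtPrime p))
        (IsLocalRing.ResidueField (Localization.AtPrime p) ⊗[A] B))
    (htor : Limits.IsZero (((Tor (ModuleCat.{u} A) 1).obj (ModuleCat.of A B)).obj
        (ModuleCat.of A (IsLocalRing.ResidueField (Localization.AtPrime p))))) :
    Algebra.IsSmoothAt A q := by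
  let S := Localization.AtPrime q
  let k := IsLocalRing.ResidueField (Localization.AtPrime p)
  obtain ⟨n, f₀, hf₀⟩ := Algebra.FiniteType.iff_quotient_mvPolynomial''.mp
    (inferInstance : Algebra.FiniteType A B)
  let M := q.primeCompl
  let M' := M.comap f₀
  let P' := Localization M'
  let fP : P' →ₐ[A] S := IsLocalization.liftAlgHom (M := M')
      (f := (IsScalarTower.toAlgHom A B S).comp f₀) fun x ↦ by
    simpa using IsLocalization.map_units (M := M) S ⟨f₀ x.1, x.2⟩
  have hf₁ : Function.Surjective fP := by
    intro x
    obtain ⟨x, ⟨s, hs⟩, rfl⟩ := IsLocalization.exists_mk'_eq M x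
    obtain ⟨x, rfl⟩ := hf₀ x
    obtain ⟨s, rfl⟩ := hf₀ s
    refine ⟨IsLocalization.mk' (M := M') _ x ⟨s, hs⟩, ?_⟩
    simp [fP, IsLocalization.lift_mk', Units.mul_inv_eq_iff_eq_mul, IsUnit.liftRight]
  have hfP : (RingHom.ker fP).FG := by
    have := Algebra.FinitePresentation.ker_fG_of_surjective _ hf₀
    convert! this.map (algebraMap _ P')
    refine le_antisymm ?_ (Ideal.map_le_iff_le_comap.mpr fun x hx ↦ by simp_all [fP])
    intro x hx
    obtain ⟨x, s, rfl⟩ := IsLocalization.exists_mk'_eq M' x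
    obtain ⟨a, ha, e⟩ : ∃ a ∈ M, a * f₀ x = 0 := by
      simpa [fP, IsLocalization.lift_mk', IsLocalization.map_eq_zero_iff M] using hx
    obtain ⟨a, rfl⟩ := hf₀ a
    rw [IsLocalization.mk'_mem_map_algebraMap_iff]
    exact ⟨a, ha, by simpa⟩
  algebraize [fP.toRingHom]
  have : Algebra.FormallyEtale (MvPolynomial (Fin n) A) P' := .of_isLocalization M'
  have : Algebra.FormallySmooth A P' := .comp _ (MvPolynomial (Fin n) A) _
  have : Module.Free P' Ω[P'⁄A] :=
    .of_equiv (KaehlerDifferential.tensorKaehlerEquivOfFormallyEtale A (MvPolynomial (Fin n) A) P')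
  have : IsScalarTower A P' S := .of_algebraMap_eq' fP.comp_algebraMap.symm
  have : Algebra.FormallySmooth k (k ⊗[A] B) := hfib.1
  have : Algebra.FormallySmooth k (k ⊗[A] S) := fiber_aux M
  obtain ⟨F, N, _, _, _, _, i, g, hF, hg, hig, hi⟩ := tor_aux _ _ htor
  have : Module.Flat B S := IsLocalization.flat S M
  have hi' : Function.Injective (i.lTensor S) := loc_aux (B := B) i hi
  let ρ : p.ResidueField →ₐ[A] q.ResidueField :=
    Ideal.ResidueField.mapₐ p q (Algebra.ofId A B) (q.over_def p)
  let : Algebra k (IsLocalRing.ResidueField S) := ρ.toRingHom.toAlgebra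
  have : IsScalarTower A k (IsLocalRing.ResidueField S) :=
    .of_algebraMap_eq' ρ.comp_algebraMap.symm
  refine local_aux (R := A) (k := k) (P := P') (S := S) hf₁ hfP ?_ ?_
  · apply surj_aux
    intro x
    obtain ⟨x, rfl⟩ := IsLocalRing.residue_surjective x
    obtain ⟨a, t, rfl⟩ := IsLocalization.exists_mk'_eq p.primeCompl x
    refine ⟨a, t, ?_, ?_⟩
    · rw [IsScalarTower.algebraMap_apply A B S]
      refine IsLocalization.map_units (M := M) S ⟨algebraMap A B t, ?_⟩
      have := t.2
      simp_all [M, q.over_def p]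
    · change (t : A) • algebraMap (Localization.AtPrime p) k _ = _
      rw [← algebraMap_smul (Localization.AtPrime p) (t : A), Algebra.smul_def, ← map_mul,
        IsLocalization.mk'_spec', ← IsScalarTower.algebraMap_apply]
  · refine chase_aux i g hg hig hi' _ (IsScalarTower.toAlgHom A P' S).toLinearMap
      Subtype.val_injective hf₁ ?_
    intro x
    simp [RingHom.mem_ker]

theorem smooth_of_smooth_fibers {A B : Type u} [CommRing A] [CommRing B] [Algebra A B]
    [Algebra.FinitePresentation A B]
    (hfin : Module.Finite B (Ω[B⁄A])) (hproj : Module.Projective B (Ω[B⁄A]))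
    (hfib : ∀ (p : Ideal A) [p.IsPrime],
      Algebra.Smooth (IsLocalRing.ResidueField (Localization.AtPrime p))
        (IsLocalRing.ResidueField (Localization.AtPrime p) ⊗[A] B))
    (htor : ∀ (p : Ideal A) [p.IsPrime],
      Limits.IsZero (((Tor (ModuleCat.{u} A) 1).obj (ModuleCat.of A B)).obj
        (ModuleCat.of A (IsLocalRing.ResidueField (Localization.AtPrime p))))) :
    Algebra.Smooth A B := by
  refine ⟨Algebra.smoothLocus_eq_univ_iff.mp (Set.eq_univ_iff_forall.mpr fun q ↦ ?_), ‹_›⟩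
  exact smoothAt_aux (q.asIdeal.under A) q.asIdeal (hfib _) (htor _)
end

section
/- Let R be a commutative ring, I ⊆ R a nilpotent ideal, and M a flat R-module. Then M/IM is a flat R/I-module and Tor_1^R(R/I, M) = 0; conversely, if M/IM is flat over R/I and Tor_i^R(R/I, M) = 0 for all i ≥ 1, then for every R/I-module N, the R-module Tor_i^R(N, M) vanishes for all i ≥ 1. -/
open CategoryTheory

universe u

open scoped TensorProduct

theorem aux_flat_ker {A N P : Type*} [CommRing A] [AddCommGroup N] [AddCommGroup P]
    [Module A N] [Module A P] [Module.Flat A N] [Module.Flat A P] (f : N →ₗ[A] P)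
    (hf : Function.Surjective f) : Module.Flat A (LinearMap.ker f) := by
  rw [Module.Flat.iff_rTensor_injective']
  intro J
  have h1 : Function.Injective ((LinearMap.ker f).subtype.lTensor J) :=
    LinearMap.lTensor_injective_of_exact_of_flat f hf _ (LinearMap.ker f).injective_subtype
      (LinearMap.exact_subtype_ker_map f) J
  have h2 : Function.Injective (LinearMap.rTensor N (Submodule.subtype J)) :=
    Module.Flat.iff_rTensor_injective'.mp ‹_› J
  have h3 : Function.Injective (((LinearMap.ker f).subtype.lTensor A) ∘ₗ
      (LinearMap.rTensor (LinearMap.ker f) (Submodule.subtype J))) := by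
    rw [LinearMap.lTensor_comp_rTensor, ← LinearMap.rTensor_comp_lTensor]
    exact h2.comp h1
  exact Function.Injective.of_comp h3

theorem aux_flat_coker {A : Type*} [CommRing A] (Q : ℕ → Type*) [∀ n, AddCommGroup (Q n)]
    [∀ n, Module A (Q n)] [∀ n, Module.Flat A (Q n)] {C : Type*} [AddCommGroup C] [Module A C]
    [Module.Flat A C] (d : ∀ n, Q (n + 1) →ₗ[A] Q n) (e : Q 0 →ₗ[A] C)
    (he : Function.Surjective e) (h0 : Function.Exact (d 0) e)
    (hd : ∀ n, Function.Exact (d (n + 1)) (d n)) (n : ℕ) :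
    Module.Flat A (Q n ⧸ LinearMap.range (d n)) := by
  induction n with
  | zero =>
    rw [← LinearMap.exact_iff.mp h0]
    exact Module.Flat.of_linearEquiv (e.quotKerEquivOfSurjective he)
  | succ n ih =>
    rw [← LinearMap.exact_iff.mp (hd n)]
    have := aux_flat_ker (LinearMap.range (d n)).mkQ (Submodule.mkQ_surjective _)
    rw [Submodule.ker_mkQ] at this
    exact Module.Flat.of_linearEquiv (d n).quotKerEquivRange

theorem aux_exact {A : Type*} [CommRing A] (Q : ℕ → Type*) [∀ n, AddCommGroup (Q n)]
    [∀ n, Module A (Q n)] [∀ n, Module.Flat A (Q n)] {C : Type*} [AddCommGroup C] [Module A C]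
    [Module.Flat A C] (d : ∀ n, Q (n + 1) →ₗ[A] Q n) (e : Q 0 →ₗ[A] C)
    (he : Function.Surjective e) (h0 : Function.Exact (d 0) e)
    (hd : ∀ n, Function.Exact (d (n + 1)) (d n)) (N : Type*) [AddCommGroup N] [Module A N]
    (n : ℕ) :
    Function.Exact ((d (n + 1)).lTensor N) ((d n).lTensor N) := by
  have := aux_flat_coker Q d e he h0 hd n
  have h1 : Function.Injective ((LinearMap.range (d n)).subtype.lTensor N) :=
    LinearMap.lTensor_injective_of_exact_of_flat (LinearMap.range (d n)).mkQ
      (Submodule.mkQ_surjective _) _ (Submodule.injective_subtype _)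
      (LinearMap.exact_subtype_mkQ _) N
  have h2 : Function.Exact (d (n + 1)) (d n).rangeRestrict := by
    intro x
    rw [← hd n x, Subtype.ext_iff]; rfl
  have h3 := lTensor_exact N h2 (LinearMap.surjective_rangeRestrict _)
  have h4 : (d n).lTensor N = ((LinearMap.range (d n)).subtype.lTensor N) ∘ₗ
      (d n).rangeRestrict.lTensor N := by
    rw [← LinearMap.lTensor_comp]; rfl
  intro x
  rw [h4, ← h3 x, LinearMap.comp_apply, map_eq_zero_iff _ h1]

theorem aux_exact_baseChange {R A : Type*} [CommRing R] [CommRing A] [Algebra R A]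
    (Q : ℕ → Type*) [∀ n, AddCommGroup (Q n)]
    [∀ n, Module R (Q n)] [∀ n, Module.Flat R (Q n)] {C : Type*} [AddCommGroup C] [Module R C]
    [Module.Flat A (A ⊗[R] C)] (d : ∀ n, Q (n + 1) →ₗ[R] Q n) (e : Q 0 →ₗ[R] C)
    (he : Function.Surjective e) (h0 : Function.Exact (d 0) e)
    (hd : ∀ n, Function.Exact ((d (n + 1)).lTensor A) ((d n).lTensor A))
    (N : Type*) [AddCommGroup N] [Module A N] [Module R N] [IsScalarTower R A N]
    (n : ℕ) :
    Function.Exact ((d (n + 1)).lTensor N) ((d n).lTensor N) := by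
  have key := aux_exact (A := A) (fun n => A ⊗[R] Q n) (fun n => (d n).baseChange A)
    (e.baseChange A) (LinearMap.lTensor_surjective A he) (lTensor_exact A h0 he) hd N n
  let E := fun n => (TensorProduct.AlgebraTensorModule.cancelBaseChange R A A N (Q n))
  have comm : ∀ n (x : N ⊗[A] (A ⊗[R] Q (n + 1))),
      (d n).lTensor N (E (n + 1) x) = E n (((d n).baseChange A).lTensor N x) := by
    intro n x
    induction x with
    | zero => simp
    | add x y hx hy => simp only [map_add, hx, hy]
    | tmul a y =>
      induction y with
      | zero => simp
      | add x y hx hy => simp only [map_add, TensorProduct.tmul_add, hx, hy]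
      | tmul b z => simp [E]
  intro x
  obtain ⟨y, rfl⟩ := (E (n + 1)).surjective x
  rw [comm, map_eq_zero_iff _ (E n).injective, key y]
  constructor
  · rintro ⟨z, rfl⟩
    exact ⟨E (n + 2) z, comm _ _⟩
  · rintro ⟨z, hz⟩
    obtain ⟨w, rfl⟩ := (E (n + 2)).surjective z
    rw [comm] at hz
    exact ⟨w, (E (n + 1)).injective hz⟩

theorem aux_tor {R : Type u} [CommRing R] {M : ModuleCat.{u} R} (P : ProjectiveResolution M)
    (N : Type u) [AddCommGroup N] [Module R N] (n : ℕ) :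
    Limits.IsZero (((Tor (ModuleCat.{u} R) (n + 1)).obj (ModuleCat.of R N)).obj M) ↔
    Function.Exact ((P.complex.d (n + 2) (n + 1)).hom.lTensor N)
      ((P.complex.d (n + 1) n).hom.lTensor N) := by
  let F := (MonoidalCategory.tensoringLeft (ModuleCat.{u} R)).obj (ModuleCat.of R N)
  let K := (F.mapHomologicalComplex _).obj P.complex
  have h1 : Limits.IsZero (((Tor (ModuleCat.{u} R) (n + 1)).obj (ModuleCat.of R N)).obj M) ↔
      Limits.IsZero (K.homology (n + 1)) := Iso.isZero_iff (P.isoLeftDerivedObj F (n + 1))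
  rw [h1, ← HomologicalComplex.exactAt_iff_isZero_homology,
    HomologicalComplex.exactAt_iff' _ (n + 2) (n + 1) n (by simp only [ChainComplex.prev]; rfl)
    (by simp), ShortComplex.ShortExact.moduleCat_exact_iff_function_exact]
  rfl

/-- For a nilpotent ideal `I ⊆ R` and an `R`-module `M`: if `M` is flat then `M/IM` is flat over
`R/I` and `Tor₁ᴿ(R/I, M) = 0`; conversely, if `M/IM` is flat over `R/I` and
`Tor_iᴿ(R/I, M) = 0` for all `i ≥ 1`, then `Tor_iᴿ(N, M) = 0` for every `R/I`-module `N` and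
all `i ≥ 1`. -/
theorem flat_nilpotent_tor_criterion {R : Type u} [CommRing R] (I : Ideal R)
    (hI : IsNilpotent I) (M : Type u) [AddCommGroup M] [Module R M] :
    (Module.Flat R M →
      Module.Flat (R ⧸ I) (M ⧸ (I • ⊤ : Submodule R M)) ∧
        Limits.IsZero
          (((Tor (ModuleCat.{u} R) 1).obj (ModuleCat.of R (R ⧸ I))).obj (ModuleCat.of R M))) ∧
    ((Module.Flat (R ⧸ I) (M ⧸ (I • ⊤ : Submodule R M)) ∧
        ∀ i : ℕ, 1 ≤ i →
          Limits.IsZero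
            (((Tor (ModuleCat.{u} R) i).obj (ModuleCat.of R (R ⧸ I))).obj (ModuleCat.of R M))) →
      ∀ (N : Type u) [AddCommGroup N] [Module (R ⧸ I) N] (i : ℕ), 1 ≤ i →
        letI : Module R N := Module.compHom N (Ideal.Quotient.mk I)
        Limits.IsZero
          (((Tor (ModuleCat.{u} R) i).obj (ModuleCat.of R N)).obj (ModuleCat.of R M))) := by
  let E : ((R ⧸ I) ⊗[R] M) ≃ₗ[R ⧸ I] M ⧸ (I • ⊤ : Submodule R M) :=
    (TensorProduct.quotTensorEquivQuotSMul M I).extendScalarsOfSurjective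
      Ideal.Quotient.mk_surjective
  let P : ProjectiveResolution (ModuleCat.of R M) := projectiveResolution _
  have hP : ∀ n, Module.Flat R (P.complex.X n) := fun n => by
    have : Module.Projective R (P.complex.X n) :=
      (IsProjective.iff_projective (P.complex.X n)).mpr (P.projective n)
    infer_instance
  let e : P.complex.X 0 →ₗ[R] M := (P.π.f 0).hom
  have he : Function.Surjective e := (ModuleCat.epi_iff_surjective (P.π.f 0)).mp inferInstance
  have h0 : Function.Exact (P.complex.d 1 0).hom e :=
    (ShortComplex.ShortExact.moduleCat_exact_iff_function_exact _).mp P.exact₀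
  have hd : ∀ n, Function.Exact (P.complex.d (n + 2) (n + 1)).hom (P.complex.d (n + 1) n).hom :=
    fun n => (ShortComplex.ShortExact.moduleCat_exact_iff_function_exact _).mp (P.exact_succ n)
  refine ⟨fun hM => ⟨Module.Flat.of_linearEquiv E.symm, ?_⟩, ?_⟩
  · rw [aux_tor P (R ⧸ I) 0]
    exact aux_exact (fun n => P.complex.X n) (fun n => (P.complex.d (n + 1) n).hom) e he h0 hd
      (R ⧸ I) 0
  · rintro ⟨hM, hT⟩ N _ _ i hi
    letI : Module R N := Module.compHom N (Ideal.Quotient.mk I)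
    obtain ⟨n, rfl⟩ : ∃ n, i = n + 1 := ⟨i - 1, by omega⟩
    have : IsScalarTower R (R ⧸ I) N := IsScalarTower.of_algebraMap_smul fun _ _ => rfl
    have : Module.Flat (R ⧸ I) ((R ⧸ I) ⊗[R] M) := Module.Flat.of_linearEquiv E
    change Limits.IsZero (((Tor (ModuleCat.{u} R) (n + 1)).obj (ModuleCat.of R N)).obj
      (ModuleCat.of R M))
    rw [aux_tor P N n]
    exact aux_exact_baseChange (A := R ⧸ I) (fun n => P.complex.X n)
      (fun n => (P.complex.d (n + 1) n).hom) e he h0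
      (fun n => (aux_tor P (R ⧸ I) n).mp (hT (n + 1) (by omega))) N n
end
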